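/- arXiv:0909.5568 — 2 statements merged into one kernel-verified Lean document; each statement's English description precedes it below -/
import Mathlib

section
/- For every nonzero λ ∈ k^c, the elements 1, u_λ, u_λ^2, …, u_λ^{a−1} of A are linearly independent over k; consequently the subalgebra k[u_λ] has k-dimension a and is isomorphic as a k-algebra to the truncated polynomial ring k[x]/(x^a). -/
/-- The defining relations of the homogeneous quantum complete intersection with `c`
generators `x_i`, all exponents equal to `a`, and all commutators equal to `q`:
`x_i ^ a = 0` for all `i`, and `x_i x_j = q • (x_j x_i)` for `i < j`. -/
inductive QCIRel (k : Type) [Field k] (c a : ℕ) (q : k) :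
    FreeAlgebra k (Fin c) → FreeAlgebra k (Fin c) → Prop
  | pow (i : Fin c) : QCIRel k c a q (FreeAlgebra.ι k i ^ a) 0
  | comm (i j : Fin c) (hij : i < j) :
      QCIRel k c a q (FreeAlgebra.ι k i * FreeAlgebra.ι k j)
        (q • (FreeAlgebra.ι k j * FreeAlgebra.ι k i))

/-- The homogeneous quantum complete intersection `A = k⟨x_1,…,x_c⟩/(x_i^a, x_ix_j - q x_jx_i)`. -/
abbrev QCI (k : Type) [Field k] (c a : ℕ) (q : k) : Type := RingQuot (QCIRel k c a q)

/-- The image of the generator `x_i` in `A`. -/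
noncomputable def Xgen (k : Type) [Field k] (c a : ℕ) (q : k) (i : Fin c) : QCI k c a q :=
  RingQuot.mkAlgHom k (QCIRel k c a q) (FreeAlgebra.ι k i)

/-- The element `u_λ = λ_1 x_1 + ⋯ + λ_c x_c` of `A`. -/
noncomputable def uElt (k : Type) [Field k] (c a : ℕ) (q : k) (lam : Fin c → k) :
    QCI k c a q :=
  ∑ i, lam i • Xgen k c a q i

/-- The Gaussian binomial coefficient evaluated at `q`, defined by the `q`-Pascal rule. -/
def gaussBinom {R : Type*} [Semiring R] (q : R) : ℕ → ℕ → R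
  | _, 0 => 1
  | 0, _ + 1 => 0
  | n + 1, k + 1 => gaussBinom q n k + q ^ (k + 1) * gaussBinom q n (k + 1)

section gaussBinom

variable {R : Type*}

@[simp]
theorem gaussBinom_zero_right [Semiring R] (q : R) (n : ℕ) : gaussBinom q n 0 = 1 := by
  cases n <;> rfl

theorem gaussBinom_succ_succ [Semiring R] (q : R) (n k : ℕ) :
    gaussBinom q (n + 1) (k + 1) = gaussBinom q n k + q ^ (k + 1) * gaussBinom q n (k + 1) :=
  rfl

theorem gaussBinom_eq_zero_of_lt [Semiring R] (q : R) {n k : ℕ} (h : n < k) :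
    gaussBinom q n k = 0 := by
  induction n generalizing k with
  | zero => obtain ⟨k, rfl⟩ := Nat.exists_eq_succ_of_ne_zero h.ne'; rfl
  | succ n ih =>
    obtain ⟨k, rfl⟩ := Nat.exists_eq_succ_of_ne_zero (Nat.ne_zero_of_lt h)
    rw [Nat.succ_eq_add_one, gaussBinom_succ_succ, ih (by omega), ih (by omega)]
    simp

@[simp]
theorem gaussBinom_self [Semiring R] (q : R) (n : ℕ) : gaussBinom q n n = 1 := by
  induction n with
  | zero => rfl
  | succ n ih => rw [gaussBinom_succ_succ, ih, gaussBinom_eq_zero_of_lt q n.lt_succ_self]; simp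

theorem gaussBinom_add_mul_prod_mul_prod [CommRing R] (q : R) (m k : ℕ) :
    gaussBinom q (m + k) k *
        ((∏ i ∈ Finset.range m, (1 - q ^ (i + 1))) * ∏ i ∈ Finset.range k, (1 - q ^ (i + 1))) =
      ∏ i ∈ Finset.range (m + k), (1 - q ^ (i + 1)) := by
  induction m generalizing k with
  | zero => simp
  | succ m ihm =>
    induction k with
    | zero => simp
    | succ k ihk =>
      have h := ihm (k + 1)
      rw [show m + 1 + k = m + k + 1 by ring] at ihk
      rw [show m + (k + 1) = m + k + 1 by ring] at h
      rw [show m + 1 + (k + 1) = m + k + 1 + 1 by ring, gaussBinom_succ_succ,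
        Finset.prod_range_succ _ (m + k + 1)]
      rw [Finset.prod_range_succ _ m] at ihk ⊢
      rw [Finset.prod_range_succ _ k] at h ⊢
      linear_combination (1 - q ^ (k + 1)) * ihk + q ^ (k + 1) * (1 - q ^ (m + 1)) * h

theorem IsPrimitiveRoot.gaussBinom_eq_zero [CommRing R] [IsDomain R] {q : R} {n k : ℕ}
    (hq : IsPrimitiveRoot q n) (hk : k ≠ 0) (hkn : k < n) : gaussBinom q n k = 0 := by
  have hprod : ∀ m < n, ∏ i ∈ Finset.range m, (1 - q ^ (i + 1)) ≠ 0 := fun m hm ↦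
    Finset.prod_ne_zero_iff.2 fun i hi ↦ sub_ne_zero.2
      (hq.pow_ne_one_of_pos_of_lt i.succ_ne_zero (by have := Finset.mem_range.1 hi; omega)).symm
  have h := gaussBinom_add_mul_prod_mul_prod q (n - k) k
  rw [Nat.sub_add_cancel hkn.le, Finset.prod_eq_zero (s := Finset.range n) (i := n - 1)
    (Finset.mem_range.2 (by omega)) (by rw [Nat.sub_add_cancel (by omega), hq.pow_eq_one, sub_self])]
    at h
  exact (mul_eq_zero.1 h).resolve_right
    (mul_ne_zero (hprod _ (by omega)) (hprod _ hkn))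

end gaussBinom

section QCommute

variable {k A : Type*} [CommRing k] [Ring A] [Algebra k A]

theorem mul_pow_of_mul_eq_smul {q : k} {x y : A} (h : x * y = q • (y * x)) (n : ℕ) :
    x * y ^ n = q ^ n • (y ^ n * x) := by
  induction n with
  | zero => simp
  | succ n ih =>
    rw [pow_succ, ← mul_assoc, ih, smul_mul_assoc, mul_assoc, h, mul_smul_comm, smul_smul,
      ← mul_assoc, pow_succ]

/-- The noncommutative `q`-binomial theorem. -/
theorem add_pow_of_mul_eq_smul {q : k} {x y : A} (h : x * y = q • (y * x)) (n : ℕ) :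
    (x + y) ^ n =
      ∑ i ∈ Finset.range (n + 1), gaussBinom q n i • (y ^ i * x ^ (n - i)) := by
  induction n with
  | zero => simp
  | succ n ih =>
    have hx : x * ∑ i ∈ Finset.range (n + 1), gaussBinom q n i • (y ^ i * x ^ (n - i)) =
        ∑ i ∈ Finset.range (n + 2), (q ^ i * gaussBinom q n i) • (y ^ i * x ^ (n + 1 - i)) := by
      rw [Finset.sum_range_succ _ (n + 1), gaussBinom_eq_zero_of_lt q n.lt_succ_self, mul_zero,
        zero_smul, add_zero, Finset.mul_sum]
      refine Finset.sum_congr rfl fun i hi ↦ ?_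
      have hi : i ≤ n := Nat.lt_succ_iff.1 (Finset.mem_range.1 hi)
      rw [mul_smul_comm, ← mul_assoc, mul_pow_of_mul_eq_smul h, smul_mul_assoc, mul_assoc,
        ← pow_succ', smul_smul, mul_comm, Nat.sub_add_comm hi]
    have hy : y * ∑ i ∈ Finset.range (n + 1), gaussBinom q n i • (y ^ i * x ^ (n - i)) =
        ∑ i ∈ Finset.range (n + 1), gaussBinom q n i • (y ^ (i + 1) * x ^ (n - i)) := by
      rw [Finset.mul_sum]
      refine Finset.sum_congr rfl fun i _ ↦ ?_
      rw [mul_smul_comm, ← mul_assoc, ← pow_succ']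
    rw [pow_succ', ih, add_mul, hx, hy, Finset.sum_range_succ' _ (n + 1),
      Finset.sum_range_succ' _ (n + 1), add_right_comm, ← Finset.sum_add_distrib]
    congr 1
    · refine Finset.sum_congr rfl fun i _ ↦ ?_
      rw [Nat.add_sub_add_right, ← add_smul, gaussBinom_succ_succ, add_comm]
    · simp

theorem IsPrimitiveRoot.add_pow_of_mul_eq_smul [IsDomain k] {q : k} {n : ℕ}
    (hq : IsPrimitiveRoot q n) (hn : n ≠ 0) {x y : A} (h : x * y = q • (y * x)) :
    (x + y) ^ n = x ^ n + y ^ n := by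
  obtain ⟨n, rfl⟩ := Nat.exists_eq_succ_of_ne_zero hn
  rw [_root_.add_pow_of_mul_eq_smul h, Finset.sum_range_succ, Finset.sum_range_succ',
    Finset.sum_eq_zero]
  · simp
  · intro i hi
    rw [hq.gaussBinom_eq_zero i.succ_ne_zero (by have := Finset.mem_range.1 hi; omega), zero_smul]

theorem sum_pow_of_mul_eq_smul {ι : Type*} [LinearOrder ι] {q : k} {n : ℕ} (hn : n ≠ 0)
    (hadd : ∀ x y : A, x * y = q • (y * x) → (x + y) ^ n = x ^ n + y ^ n)
    {z : ι → A} (hz : ∀ i j, i < j → z i * z j = q • (z j * z i)) (s : Finset ι) :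
    (∑ i ∈ s, z i) ^ n = ∑ i ∈ s, z i ^ n := by
  induction s using Finset.induction_on_max with
  | empty => simp [hn]
  | insert m s hm ih =>
    have hms : m ∉ s := fun h ↦ lt_irrefl _ (hm m h)
    rw [Finset.sum_insert hms, Finset.sum_insert hms, add_comm, hadd, ih, add_comm]
    rw [Finset.sum_mul, Finset.mul_sum, Finset.smul_sum]
    exact Finset.sum_congr rfl fun i hi ↦ hz i m (hm i hi)

end QCommute

section QCI

variable {k : Type} [Field k] {c a : ℕ} {q : k}

theorem Xgen_pow (i : Fin c) : Xgen k c a q i ^ a = 0 := by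
  rw [Xgen, ← map_pow, RingQuot.mkAlgHom_rel k (QCIRel.pow i), map_zero]

theorem Xgen_mul_Xgen {i j : Fin c} (hij : i < j) :
    Xgen k c a q i * Xgen k c a q j = q • (Xgen k c a q j * Xgen k c a q i) := by
  rw [Xgen, Xgen, ← map_mul, RingQuot.mkAlgHom_rel k (QCIRel.comm i j hij), map_smul, map_mul]

theorem exists_algHom_uElt_eq {B : Type*} [Ring B] [Algebra k B] {x : B} (hx : x ^ a = 0)
    (ha : a ≠ 0) {lam : Fin c → k} (hlam : lam ≠ 0) :
    ∃ f : QCI k c a q →ₐ[k] B, f (uElt k c a q lam) = x := by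
  obtain ⟨j, hj⟩ := Function.ne_iff.1 hlam
  let g : FreeAlgebra k (Fin c) →ₐ[k] B := FreeAlgebra.lift k (Pi.single j ((lam j)⁻¹ • x))
  have hg : ∀ i, g (FreeAlgebra.ι k i) = Pi.single (M := fun _ ↦ B) j ((lam j)⁻¹ • x) i :=
    fun i ↦ FreeAlgebra.lift_ι_apply _ _
  have hrel : ∀ ⦃y z⦄, QCIRel k c a q y z → g y = g z := by
    rintro _ _ (⟨i⟩ | ⟨i, l, hil⟩)
    · rw [map_pow, hg, map_zero]
      rcases eq_or_ne i j with rfl | hij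
      · rw [Pi.single_eq_same, smul_pow, hx, smul_zero]
      · rw [Pi.single_eq_of_ne hij, zero_pow ha]
    · rw [map_smul, map_mul, map_mul, hg, hg]
      rcases eq_or_ne i j with rfl | hij
      · simp [Pi.single_eq_of_ne hil.ne']
      · simp [Pi.single_eq_of_ne hij]
  refine ⟨RingQuot.liftAlgHom k ⟨g, hrel⟩, ?_⟩
  simp only [uElt, Xgen, map_sum, map_smul, RingQuot.liftAlgHom_mkAlgHom_apply, hg]
  rw [Finset.sum_eq_single j (fun i _ hij ↦ by rw [Pi.single_eq_of_ne hij, smul_zero])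
    (fun h ↦ absurd (Finset.mem_univ j) h), Pi.single_eq_same, smul_smul,
    mul_inv_cancel₀ hj, one_smul]

theorem smul_Xgen_mul_smul_Xgen (lam : Fin c → k) {i j : Fin c} (hij : i < j) :
    (lam i • Xgen k c a q i) * (lam j • Xgen k c a q j) =
      q • ((lam j • Xgen k c a q j) * (lam i • Xgen k c a q i)) := by
  rw [smul_mul_smul_comm, smul_mul_smul_comm, Xgen_mul_Xgen hij, smul_comm, mul_comm]

theorem uElt_pow (ha : a ≠ 0) {b : ℕ}
    (hb : b = if ringChar k = 0 then a else a / Nat.gcd a (ringChar k))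
    (hq : IsPrimitiveRoot q b) (lam : Fin c → k) : uElt k c a q lam ^ a = 0 := by
  have hzero : ∀ i, (lam i • Xgen k c a q i) ^ a = 0 := fun i ↦ by
    rw [smul_pow, Xgen_pow, smul_zero]
  have hb0 : b ≠ 0 := by
    rw [hb]
    split_ifs
    · exact ha
    · exact (Nat.div_pos (Nat.gcd_le_left _ (Nat.pos_of_ne_zero ha))
        (Nat.gcd_pos_of_pos_left _ (Nat.pos_of_ne_zero ha))).ne'
  have hub : uElt k c a q lam ^ b = ∑ i, (lam i • Xgen k c a q i) ^ b :=
    sum_pow_of_mul_eq_smul hb0 (fun _ _ h ↦ hq.add_pow_of_mul_eq_smul hb0 h)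
      (fun _ _ hij ↦ smul_Xgen_mul_smul_Xgen lam hij) _
  by_cases hab : a = b
  · rw [← hab] at hub
    rw [hub, Finset.sum_eq_zero fun i _ ↦ hzero i]
  have hp0 : ringChar k ≠ 0 := fun h ↦ hab (by rw [hb, if_pos h])
  have hp : (ringChar k).Prime := (CharP.char_is_prime_or_zero k _).resolve_right hp0
  rw [if_neg hp0] at hb
  have hgcd : a.gcd (ringChar k) = ringChar k :=
    ((Nat.dvd_prime hp).1 (Nat.gcd_dvd_right _ _)).resolve_left fun h ↦
      hab (by rw [hb, h, Nat.div_one])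
  have hbp : b * ringChar k = a := by
    rw [hb, hgcd]
    exact Nat.div_mul_cancel (hgcd ▸ Nat.gcd_dvd_left a (ringChar k))
  rcases subsingleton_or_nontrivial (QCI k c a q) with _ | _
  · exact Subsingleton.elim _ _
  have : CharP (QCI k c a q) (ringChar k) :=
    charP_of_injective_algebraMap (algebraMap k (QCI k c a q)).injective _
  have : Fact (ringChar k).Prime := ⟨hp⟩
  have hcomm : ∀ i j : Fin c, i < j →
      (lam i • Xgen k c a q i) ^ b * (lam j • Xgen k c a q j) ^ b =
        (1 : k) • ((lam j • Xgen k c a q j) ^ b * (lam i • Xgen k c a q i) ^ b) := by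
    intro i j hij
    have h := mul_pow_of_mul_eq_smul (smul_Xgen_mul_smul_Xgen (a := a) (q := q) lam hij) b
    rw [hq.pow_eq_one, one_smul] at h
    rw [one_smul]
    exact Commute.pow_left (show Commute _ _ from h) b
  rw [← hbp, pow_mul, hbp, hub, sum_pow_of_mul_eq_smul hp0
    (fun x y h ↦ add_pow_char_of_commute _ (by rwa [one_smul] at h)) hcomm]
  refine Finset.sum_eq_zero fun i _ ↦ ?_
  rw [← pow_mul, hbp, hzero]

end QCI

section TruncatedPolynomial

open Polynomial

variable {k A : Type*} [Field k] [Ring A] [Algebra k A]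

/-- If `u ^ a = 0` and `u` maps to the class of `X` under some algebra homomorphism
`A → k[X]/(X^a)`, then `k[u]` is isomorphic to `k[X]/(X^a)`. -/
theorem nonempty_algEquiv_adjoin_singleton {a : ℕ} {u : A} (hu : u ^ a = 0)
    (f : A →ₐ[k] k[X] ⧸ Ideal.span {(X : k[X]) ^ a}) (hf : f u = Ideal.Quotient.mk _ X) :
    Nonempty (Algebra.adjoin k {u} ≃ₐ[k] k[X] ⧸ Ideal.span {(X : k[X]) ^ a}) := by
  have hker : ∀ p ∈ Ideal.span {(X : k[X]) ^ a}, aeval u p = 0 := by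
    intro p hp
    obtain ⟨r, rfl⟩ := Ideal.mem_span_singleton.1 hp
    rw [map_mul, map_pow, aeval_X, hu, zero_mul]
  let g : (k[X] ⧸ Ideal.span {(X : k[X]) ^ a}) →ₐ[k] A :=
    Ideal.Quotient.liftₐ _ (aeval u) hker
  have hfg : f.comp (aeval u) = Ideal.Quotient.mkₐ k (Ideal.span {(X : k[X]) ^ a}) :=
    Polynomial.algHom_ext (by simp [hf])
  have hinj : Function.Injective g := by
    refine Function.LeftInverse.injective (g := f) fun y ↦ ?_
    obtain ⟨p, rfl⟩ := Ideal.Quotient.mk_surjective y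
    exact DFunLike.congr_fun hfg p
  have hrange : g.range = Algebra.adjoin k {u} := by
    rw [Algebra.adjoin_singleton_eq_range_aeval]
    ext y
    constructor
    · rintro ⟨z, rfl⟩
      obtain ⟨p, rfl⟩ := Ideal.Quotient.mk_surjective z
      exact ⟨p, rfl⟩
    · rintro ⟨p, rfl⟩
      exact ⟨Ideal.Quotient.mk _ p, rfl⟩
  exact ⟨((AlgEquiv.ofInjective g hinj).trans (Subalgebra.equivOfEq _ _ hrange)).symm⟩

end TruncatedPolynomial

/-- for every nonzero `λ ∈ k^c`, the elements `1, u_λ, …, u_λ^{a-1}` are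
linearly independent over `k`; consequently the subalgebra `k[u_λ]` has `k`-dimension `a`
and is isomorphic as a `k`-algebra to the truncated polynomial ring `k[x]/(x^a)`. -/
theorem statement4 (k : Type) [Field k] [IsAlgClosed k] (c a : ℕ) (hc : 2 ≤ c) (ha : 2 ≤ a)
    (b : ℕ) (hb : b = if ringChar k = 0 then a else a / Nat.gcd a (ringChar k))
    (q : k) (hq : IsPrimitiveRoot q b) (lam : Fin c → k) (hlam : lam ≠ 0) :
    LinearIndependent k (fun i : Fin a => uElt k c a q lam ^ (i : ℕ)) ∧
    Module.finrank k (Algebra.adjoin k {uElt k c a q lam}) = a ∧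
    Nonempty ((Algebra.adjoin k {uElt k c a q lam}) ≃ₐ[k]
      (Polynomial k ⧸ Ideal.span {(Polynomial.X : Polynomial k) ^ a})) := by
  have ha0 : a ≠ 0 := by omega
  obtain ⟨f, hf⟩ := exists_algHom_uElt_eq (q := q) (a := a)
    (x := Ideal.Quotient.mk (Ideal.span {(Polynomial.X : Polynomial k) ^ a}) Polynomial.X)
    (by rw [← map_pow]; exact Ideal.Quotient.eq_zero_iff_mem.2 (Ideal.mem_span_singleton_self _))
    ha0 hlam
  obtain ⟨e⟩ := nonempty_algEquiv_adjoin_singleton (uElt_pow ha0 hb hq lam) f hf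
  let B : PowerBasis k (Polynomial k ⧸ Ideal.span {(Polynomial.X : Polynomial k) ^ a}) :=
    AdjoinRoot.powerBasis (pow_ne_zero a Polynomial.X_ne_zero)
  have hgen : B.gen = Ideal.Quotient.mk _ Polynomial.X := rfl
  have hdim : B.dim = a := Polynomial.natDegree_X_pow a
  refine ⟨?_, ?_, ⟨e⟩⟩
  · have h : LinearIndependent k fun i : Fin B.dim ↦ uElt k c a q lam ^ (i : ℕ) := by
      refine LinearIndependent.of_comp f.toLinearMap ?_
      have hB : (f.toLinearMap ∘ fun i : Fin B.dim ↦ uElt k c a q lam ^ (i : ℕ)) = B.basis := by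
        funext i
        simp [hf, hgen, B.basis_eq_pow]
      exact hB ▸ B.basis.linearIndependent
    exact (linearIndependent_equiv' (finCongr hdim) rfl).1 h
  · rw [e.toLinearEquiv.finrank_eq, B.finrank, hdim]
end

section
/- Suppose a = 2 and let λ ∈ k^c be nonzero. Then the k-vector space Ext^1_A(A u_λ, A u_λ), computed in the category of left A-modules, has dimension exactly 2^{c−1}. -/
section

open CategoryTheory

variable {A : Type} [Ring A]

/-- Right multiplication by `u`, as an endomorphism of the regular left module. -/
noncomputable abbrev mulRightHom (u : A) : ModuleCat.of A A ⟶ ModuleCat.of A A :=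
  ModuleCat.ofHom (LinearMap.toSpanSingleton A A u)

theorem mulRightHom_comp_self {u : A} (hu : u * u = 0) : mulRightHom u ≫ mulRightHom u = 0 := by
  ext
  simp [hu]

/-- The periodic complex `⋯ ⟶ A ⟶ A ⟶ A` all of whose differentials are right multiplication
by `u`. -/
noncomputable abbrev mulRightComplex {u : A} (hu : u * u = 0) : ChainComplex (ModuleCat A) ℕ :=
  HomologicalComplex.alternatingConst (ModuleCat.of A A)
    (mulRightHom_comp_self hu) (mulRightHom_comp_self hu)
    fun _ _ => ComplexShape.down_nat_odd_add

theorem mulRightComplex_d_comp {u : A} (hu : u * u = 0) (i j : ℕ) {N : ModuleCat A}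
    (g : ModuleCat.of A A ⟶ N) (hg : mulRightHom u ≫ g = 0) :
    (mulRightComplex hu).d i j ≫ g = 0 := by
  have h : ∀ f : ModuleCat.of A A ⟶ ModuleCat.of A A, f = mulRightHom u ∨ f = 0 → f ≫ g = 0 := by
    rintro f (rfl | rfl)
    exacts [hg, Limits.zero_comp]
  refine h _ ?_
  change (if _ : _ then if _ : _ then mulRightHom u else mulRightHom u else 0) = _ ∨
    (if _ : _ then if _ : _ then mulRightHom u else mulRightHom u else 0) = _
  split_ifs <;> simp

/-- The left ideal `A u`. -/
noncomputable abbrev leftIdeal (u : A) : ModuleCat A :=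
  ModuleCat.of A (LinearMap.range (LinearMap.toSpanSingleton A A u))

/-- The augmentation of `mulRightComplex` to `A u`. -/
noncomputable def mulRightComplexπ {u : A} (hu : u * u = 0) :
    mulRightComplex hu ⟶ (ChainComplex.single₀ (ModuleCat A)).obj (leftIdeal u) :=
  ((mulRightComplex hu).toSingle₀Equiv (leftIdeal u)).symm
    ⟨ModuleCat.ofHom (LinearMap.toSpanSingleton A A u).rangeRestrict, by
      refine mulRightComplex_d_comp hu 1 0 _ ?_
      ext
      exact show ((1 : A) • u) • u = 0 by simp [hu]⟩

theorem mulRightComplexπ_quasiIso {u : A} (hu : u * u = 0)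
    (hker : ∀ x : A, x * u = 0 → ∃ y, x = y * u) : QuasiIso (mulRightComplexπ hu) where
  quasiIsoAt m := by
    have hrange : ∀ x : A, x * u = 0 ↔ ∃ y, y * u = x := fun x =>
      ⟨fun h => (hker x h).imp fun _ h => h.symm, by rintro ⟨y, rfl⟩; rw [mul_assoc, hu, mul_zero]⟩
    induction m with
    | zero =>
      simp only [mulRightComplexπ]
      rw [ChainComplex.quasiIsoAt₀_iff, ShortComplex.quasiIso_iff_of_zeros' _ rfl rfl rfl]
      constructor
      · rw [ShortComplex.moduleCat_exact_iff]
        intro x hx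
        obtain ⟨y, hy⟩ := (hrange _).1 (congrArg Subtype.val hx)
        exact ⟨y, by simpa [HomologicalComplex.alternatingConst] using! hy⟩
      · rw [ModuleCat.epi_iff_surjective]
        rintro ⟨x, y, rfl⟩
        exact ⟨y, rfl⟩
    | succ m _ =>
      rw [quasiIsoAt_iff_exactAt' (hL := ChainComplex.exactAt_succ_single_obj ..),
          HomologicalComplex.exactAt_iff' _ (m + 2) (m + 1) m (by simp) (by simp)]
      rw [ShortComplex.moduleCat_exact_iff]
      intro x hx
      obtain ⟨y, hy⟩ := (hrange _).1
        (by simpa [HomologicalComplex.alternatingConst] using! hx)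
      exact ⟨y, by simpa [HomologicalComplex.alternatingConst] using! hy⟩

/-- If the left annihilator of `u` is `A u`, then `mulRightComplex` is a projective resolution
of `A u`. -/
noncomputable def mulRightResolution {u : A} (hu : u * u = 0)
    (hker : ∀ x : A, x * u = 0 → ∃ y, x = y * u) : ProjectiveResolution (leftIdeal u) where
  complex := mulRightComplex hu
  projective _ := inferInstanceAs <| Projective (ModuleCat.of A A)
  π := mulRightComplexπ hu
  quasiIso := mulRightComplexπ_quasiIso hu hker

variable {k : Type} [Field k] [Algebra k A]

theorem finrank_hom_leftIdeal (u : A) :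
    @Module.finrank k (ModuleCat.of A A ⟶ leftIdeal u) _ _ (Linear.homModule _ _) =
      Module.finrank k (LinearMap.range (LinearMap.mulRight k u)) := by
  let _ : Module k (ModuleCat.of A A ⟶ leftIdeal u) := Linear.homModule _ _
  let F : (ModuleCat.of A A ⟶ leftIdeal u) →ₗ[k] A :=
    { toFun g := (g (1 : A)).1
      map_add' _ _ := rfl
      map_smul' r g := by
        rw [RingHom.id_apply, Algebra.smul_def]
        rfl }
  have hF : Function.Injective F := by
    intro g h hgh
    ext
    exact hgh
  rw [← LinearMap.finrank_range_of_inj hF]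
  suffices h : LinearMap.range F = LinearMap.range (LinearMap.mulRight k u) by rw [h]
  ext x
  constructor
  · rintro ⟨g, rfl⟩
    obtain ⟨y, hy⟩ := (g (1 : A)).2
    exact ⟨y, hy⟩
  · rintro ⟨y, rfl⟩
    refine ⟨ModuleCat.ofHom (LinearMap.toSpanSingleton A _ ⟨y * u, y, rfl⟩), ?_⟩
    simp [F]

/-- The homology of a complex with zero differentials is the complex itself. -/
noncomputable def homologyIsoXOfDEqZero {C ι : Type*} [Category C] [Abelian C]
    {c : ComplexShape ι} (K : HomologicalComplex C c) (hK : ∀ i j, K.d i j = 0) (i : ι) :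
    K.homology i ≅ K.X i :=
  (ShortComplex.HomologyData.ofZeros (K.sc i) (hK _ _) (hK _ _)).left.homologyIso

theorem mulRightHom_comp_eq_zero {u : A} (hu : ∀ x : A, u * x * u = 0)
    (g : ModuleCat.of A A ⟶ leftIdeal u) : mulRightHom u ≫ g = 0 := by
  ext
  obtain ⟨y, hy⟩ := (g (1 : A)).2
  have : g u = u • g (1 : A) := by rw [← map_smul]; simp
  simp at hy
  simp [this, ← hy, ← mul_assoc, hu]

theorem finrank_ext_of_d_comp_eq_zero {M N : ModuleCat A} (P : ProjectiveResolution M)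
    (h : ∀ i j (g : P.complex.X j ⟶ N), P.complex.d i j ≫ g = 0) (n : ℕ) {X : ModuleCat A}
    (hX : P.complex.X n = X) :
    Module.finrank k (((Ext k (ModuleCat A) n).obj (Opposite.op M)).obj N) =
      Module.finrank k (X ⟶ N) := by
  subst hX
  have hd (i j : ℕ) : (P.complex.linearYonedaObj k N).d i j = 0 := by
    ext g
    exact h j i g
  exact (P.isoExt n N ≪≫ homologyIsoXOfDEqZero _ hd n).toLinearEquiv.finrank_eq

theorem finrank_ext_one_leftIdeal {u : A} (hu : ∀ x : A, u * x * u = 0)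
    (hker : ∀ x : A, x * u = 0 → ∃ y, x = y * u) :
    Module.finrank k (((Ext k (ModuleCat A) 1).obj (Opposite.op (leftIdeal u))).obj (leftIdeal u)) =
      Module.finrank k (LinearMap.range (LinearMap.mulRight k u)) := by
  have huu : u * u = 0 := by simpa using hu 1
  have h : ∀ i j (g : (mulRightResolution huu hker).complex.X j ⟶ leftIdeal u),
      (mulRightResolution huu hker).complex.d i j ≫ g = 0 := fun i j g =>
    mulRightComplex_d_comp huu i j g (mulRightHom_comp_eq_zero hu g)
  rw [← finrank_hom_leftIdeal (k := k) u]
  exact finrank_ext_of_d_comp_eq_zero (k := k) (mulRightResolution huu hker) h 1 rfl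
end

namespace ExteriorAlgebra
variable {k V : Type*} [Field k] [AddCommGroup V] [Module k V]

theorem exists_ι_mul_eq_mul_ι (v : V) (x : ExteriorAlgebra k V) :
    ∃ y, ι k v * x = y * ι k v := by
  induction x using ExteriorAlgebra.induction with
  | algebraMap r => exact ⟨algebraMap k _ r, (Algebra.commutes r _).symm⟩
  | ι w => exact ⟨-ι k w, by rw [neg_mul, eq_neg_iff_add_eq_zero, ι_add_mul_swap]⟩
  | mul a b ha hb =>
    obtain ⟨a', ha⟩ := ha
    obtain ⟨b', hb⟩ := hb
    exact ⟨a' * b', by rw [← mul_assoc, ha, mul_assoc, hb, mul_assoc]⟩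
  | add a b ha hb =>
    obtain ⟨a', ha⟩ := ha
    obtain ⟨b', hb⟩ := hb
    exact ⟨a' + b', by rw [mul_add, ha, hb, add_mul]⟩

theorem ι_mul_mul_ι (v : V) (x : ExteriorAlgebra k V) : ι k v * x * ι k v = 0 := by
  obtain ⟨y, hy⟩ := exists_ι_mul_eq_mul_ι v x
  rw [hy, mul_assoc, ι_sq_zero, mul_zero]

theorem exists_eq_mul_ι_of_mul_ι_eq_zero {v : V} (hv : v ≠ 0) {x : ExteriorAlgebra k V}
    (hx : x * ι k v = 0) : ∃ y, x = y * ι k v := by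
  obtain ⟨d, hd⟩ := Module.Projective.exists_dual_ne_zero k hv
  have h := CliffordAlgebra.contractRight_mul_ι (Q := (0 : QuadraticForm k V)) d v x
  refine ⟨(d v)⁻¹ • CliffordAlgebra.contractRight (Q := (0 : QuadraticForm k V)) x d, ?_⟩
  rw [show x * CliffordAlgebra.ι (0 : QuadraticForm k V) v = 0 from hx, map_zero,
    LinearMap.zero_apply, eq_comm, sub_eq_zero] at h
  rw [smul_mul_assoc, eq_inv_smul_iff₀ hd]
  exact h

theorem finrank_range_mulRight_ι [FiniteDimensional k V] {v : V} (hv : v ≠ 0) :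
    Module.finrank k (LinearMap.range (LinearMap.mulRight k (ι k v))) =
      2 ^ (Module.finrank k V - 1) := by
  have B := (Module.finBasis k V).ExteriorAlgebra
  have : FiniteDimensional k (ExteriorAlgebra k V) := B.finiteDimensional_of_finite
  have hdim : Module.finrank k (ExteriorAlgebra k V) = 2 ^ Module.finrank k V := by
    rw [Module.finrank_eq_card_basis B]; simp
  have hker : LinearMap.ker (LinearMap.mulRight k (ι k v)) =
      LinearMap.range (LinearMap.mulRight k (ι k v)) := by
    ext x
    constructor
    · intro hx
      obtain ⟨y, rfl⟩ := exists_eq_mul_ι_of_mul_ι_eq_zero hv hx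
      exact ⟨y, rfl⟩
    · rintro ⟨y, rfl⟩
      simp [mul_assoc]
  have hrk := LinearMap.finrank_range_add_finrank_ker (LinearMap.mulRight k (ι k v))
  have : Nontrivial V := ⟨v, 0, hv⟩
  obtain ⟨n, hn⟩ := Nat.exists_eq_succ_of_ne_zero (Module.finrank_pos (R := k) (M := V)).ne'
  rw [hker, hdim, hn, pow_succ] at hrk
  rw [hn, Nat.succ_sub_one]
  lia

end ExteriorAlgebra

theorem IsPrimitiveRoot.eq_neg_one_of_two_div_gcd_ringChar {k : Type*} [Field k] {q : k}
    (hq : IsPrimitiveRoot q (if ringChar k = 0 then 2 else 2 / Nat.gcd 2 (ringChar k))) :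
    q = -1 := by
  split_ifs at hq with h0
  · exact hq.eq_neg_one_of_two_right
  · have hp : (ringChar k).Prime := (CharP.char_is_prime_or_zero k _).resolve_right h0
    rcases hp.eq_two_or_odd' with h2 | hodd
    · have : CharP k 2 := ringChar.of_eq h2
      rw [h2] at hq
      simpa [CharTwo.neg_eq] using hq
    · rw [(Nat.coprime_two_left.2 hodd).gcd_eq_one] at hq
      exact hq.eq_neg_one_of_two_right

namespace QCI

variable {k : Type} [Field k] {c : ℕ}

theorem Xgen_mul_self (q : k) (i : Fin c) : Xgen k c 2 q i * Xgen k c 2 q i = 0 := by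
  have h := RingQuot.mkAlgHom_rel k (QCIRel.pow (k := k) (c := c) (a := 2) (q := q) i)
  rwa [map_zero, pow_two, map_mul] at h

theorem Xgen_mul_of_lt (a : ℕ) (q : k) {i j : Fin c} (hij : i < j) :
    Xgen k c a q i * Xgen k c a q j = q • (Xgen k c a q j * Xgen k c a q i) := by
  have h := RingQuot.mkAlgHom_rel k (QCIRel.comm (k := k) (c := c) (a := a) (q := q) i j hij)
  rwa [map_smul, map_mul, map_mul] at h

theorem Xgen_mul_add_swap (a : ℕ) {i j : Fin c} (hij : i ≠ j) :
    Xgen k c a (-1) i * Xgen k c a (-1) j + Xgen k c a (-1) j * Xgen k c a (-1) i = 0 := by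
  have key {B : Type} [Ring B] [Algebra k B] {x y : B} (h : x = (-1 : k) • y) : x + y = 0 := by
    rw [h, neg_one_smul, neg_add_cancel]
  rcases hij.lt_or_gt with h | h
  · exact key (Xgen_mul_of_lt a _ h)
  · rw [add_comm]
    exact key (Xgen_mul_of_lt a _ h)

theorem uElt_mul_self (lam : Fin c → k) :
    uElt k c 2 (-1) lam * uElt k c 2 (-1) lam = 0 := by
  classical
  unfold uElt
  induction (Finset.univ : Finset (Fin c)) using Finset.induction_on with
  | empty => simp
  | insert i s hi ih =>
    have hswap : lam i • Xgen k c 2 (-1) i * ∑ j ∈ s, lam j • Xgen k c 2 (-1) j +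
        (∑ j ∈ s, lam j • Xgen k c 2 (-1) j) * lam i • Xgen k c 2 (-1) i = 0 := by
      rw [Finset.mul_sum, Finset.sum_mul, ← Finset.sum_add_distrib]
      refine Finset.sum_eq_zero fun j hj => ?_
      have hij : i ≠ j := fun h => hi (h ▸ hj)
      rw [smul_mul_smul_comm, smul_mul_smul_comm, mul_comm (lam j), ← smul_add,
        Xgen_mul_add_swap 2 hij, smul_zero]
    rw [Finset.sum_insert hi, add_mul, mul_add, mul_add, ih, smul_mul_smul_comm,
      Xgen_mul_self, smul_zero, zero_add, add_zero, hswap]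

/-- The algebra map from the quantum complete intersection with `a = 2` and `q = -1` to the
exterior algebra. -/
noncomputable def toExterior (k : Type) [Field k] (c : ℕ) :
    QCI k c 2 (-1) →ₐ[k] ExteriorAlgebra k (Fin c → k) :=
  RingQuot.liftAlgHom k ⟨FreeAlgebra.lift k fun i => ExteriorAlgebra.ι k (Pi.single i 1), by
    intro x y h
    induction h with
    | pow i => simp [pow_two]
    | comm i j hij =>
      simp [eq_neg_iff_add_eq_zero]⟩

@[simp]
theorem toExterior_Xgen (i : Fin c) :
    toExterior k c (Xgen k c 2 (-1) i) = ExteriorAlgebra.ι k (Pi.single i 1) := by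
  simp [toExterior, Xgen]

@[simp]
theorem toExterior_uElt (lam : Fin c → k) :
    toExterior k c (uElt k c 2 (-1) lam) = ExteriorAlgebra.ι k lam := by
  simp_rw [uElt, map_sum, map_smul, toExterior_Xgen, ← map_smul, ← map_sum]
  congr 1
  ext i
  simp [Pi.single_apply]

/-- The algebra map from the exterior algebra to the quantum complete intersection with `a = 2`
and `q = -1`. -/
noncomputable def ofExterior (k : Type) [Field k] (c : ℕ) :
    ExteriorAlgebra k (Fin c → k) →ₐ[k] QCI k c 2 (-1) :=
  ExteriorAlgebra.lift k ⟨Fintype.linearCombination k (Xgen k c 2 (-1)), uElt_mul_self⟩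

@[simp]
theorem ofExterior_ι (lam : Fin c → k) :
    ofExterior k c (ExteriorAlgebra.ι k lam) = uElt k c 2 (-1) lam :=
  ExteriorAlgebra.lift_ι_apply ..

/-- The quantum complete intersection with `a = 2` and `q = -1` is the exterior algebra. -/
noncomputable def equivExterior (k : Type) [Field k] (c : ℕ) :
    QCI k c 2 (-1) ≃ₐ[k] ExteriorAlgebra k (Fin c → k) :=
  AlgEquiv.ofAlgHom (toExterior k c) (ofExterior k c)
    (by ext; simp)
    (by
      ext i
      change ofExterior k c (toExterior k c (Xgen k c 2 (-1) i)) = Xgen k c 2 (-1) i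
      rw [toExterior_Xgen, ofExterior_ι]
      simp [uElt, Pi.single_apply])

theorem equivExterior_uElt (lam : Fin c → k) :
    equivExterior k c (uElt k c 2 (-1) lam) = ExteriorAlgebra.ι k lam :=
  toExterior_uElt lam

theorem uElt_mul_mul_uElt (lam : Fin c → k) (x : QCI k c 2 (-1)) :
    uElt k c 2 (-1) lam * x * uElt k c 2 (-1) lam = 0 := by
  apply (equivExterior k c).injective
  rw [map_mul, map_mul, equivExterior_uElt, map_zero, ExteriorAlgebra.ι_mul_mul_ι]

theorem exists_eq_mul_uElt_of_mul_uElt_eq_zero {lam : Fin c → k} (hlam : lam ≠ 0)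
    {x : QCI k c 2 (-1)} (hx : x * uElt k c 2 (-1) lam = 0) :
    ∃ y, x = y * uElt k c 2 (-1) lam := by
  have h : equivExterior k c x * ExteriorAlgebra.ι k lam = 0 := by
    rw [← equivExterior_uElt, ← map_mul, hx, map_zero]
  obtain ⟨y, hy⟩ := ExteriorAlgebra.exists_eq_mul_ι_of_mul_ι_eq_zero hlam h
  refine ⟨(equivExterior k c).symm y, (equivExterior k c).injective ?_⟩
  rw [map_mul, equivExterior_uElt, AlgEquiv.apply_symm_apply, hy]

theorem finrank_range_mulRight_uElt {lam : Fin c → k} (hlam : lam ≠ 0) :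
    Module.finrank k (LinearMap.range (LinearMap.mulRight k (uElt k c 2 (-1) lam))) =
      2 ^ (c - 1) := by
  have h : (LinearMap.range (LinearMap.mulRight k (uElt k c 2 (-1) lam))).map
      ((equivExterior k c).toLinearEquiv : QCI k c 2 (-1) →ₗ[k] _) =
      LinearMap.range (LinearMap.mulRight k (ExteriorAlgebra.ι k lam)) := by
    ext x
    constructor
    · rintro ⟨_, ⟨y, rfl⟩, rfl⟩
      exact ⟨equivExterior k c y, by simp [equivExterior_uElt]⟩
    · rintro ⟨y, rfl⟩
      exact ⟨_, ⟨(equivExterior k c).symm y, rfl⟩, by simp [equivExterior_uElt]⟩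
  rw [← LinearEquiv.finrank_map_eq (equivExterior k c).toLinearEquiv, h,
    ExteriorAlgebra.finrank_range_mulRight_ι hlam, Module.finrank_fin_fun]

end QCI

open CategoryTheory in
/-- suppose `a = 2` and `λ ∈ k^c` is nonzero.  Then the `k`-vector space
`Ext¹_A(A u_λ, A u_λ)`, computed in the category of left `A`-modules, has dimension
exactly `2^{c-1}`. -/
theorem statement12 (k : Type) [Field k] [IsAlgClosed k] (c a : ℕ) (hc : 2 ≤ c)
    (ha : 2 ≤ a) (ha2 : a = 2)
    (b : ℕ) (hb : b = if ringChar k = 0 then a else a / Nat.gcd a (ringChar k))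
    (q : k) (hq : IsPrimitiveRoot q b) (lam : Fin c → k) (hlam : lam ≠ 0) :
    Module.finrank k
      (((Ext k (ModuleCat (QCI k c a q)) 1).obj
        (Opposite.op (ModuleCat.of (QCI k c a q)
          (LinearMap.range (LinearMap.toSpanSingleton (QCI k c a q) (QCI k c a q)
            (uElt k c a q lam)))))).obj
        (ModuleCat.of (QCI k c a q)
          (LinearMap.range (LinearMap.toSpanSingleton (QCI k c a q) (QCI k c a q)
            (uElt k c a q lam))))) = 2 ^ (c - 1) := by
  subst ha2 hb
  obtain rfl := hq.eq_neg_one_of_two_div_gcd_ringChar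
  exact (finrank_ext_one_leftIdeal (QCI.uElt_mul_mul_uElt lam)
    fun _ => QCI.exists_eq_mul_uElt_of_mul_uElt_eq_zero hlam).trans
    (QCI.finrank_range_mulRight_uElt hlam)
end
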